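/- Fix f ∈ L²(m), T > 0, and define h(t,x) := ∫₀^∞ J₀(2√(xs)) e^{-2(T-t)s} (P_s f, f) ds for x ≥ 0 and t ∈ [0,T). Then h satisfies the PDE h_t + 2x h_{xx} + 2 h_x = 0 with h(0,x) = (𝒥^{2T}_x f, f), and for any S < T one has the uniform bound 0 ≤ h(t,x) ≤ (U^{2(T-S)} f, f) for all t ≤ S, x ≥ 0. -/

import Mathlib

open MeasureTheory Real

/-- Bessel function of the first kind of order 0. -/
noncomputable def besselJ0 (x : ℝ) : ℝ :=
  ∑' n : ℕ, (-1) ^ n * (x / 2) ^ (2 * n) / ((Nat.factorial n) : ℝ) ^ 2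

lemma exp_hasSum (x : ℝ) : HasSum (fun n : ℕ => x ^ n / (n.factorial : ℝ)) (Real.exp x) := by
  rw [Real.exp_eq_exp_ℝ]; exact NormedSpace.expSeries_div_hasSum_exp x

lemma bessel_sqrt {y : ℝ} (hy : 0 ≤ y) :
    besselJ0 (2 * Real.sqrt y) = ∑' n : ℕ, (-y) ^ n / ((n.factorial : ℝ)) ^ 2 := by
  unfold besselJ0
  refine tsum_congr fun n => ?_
  have : 2 * Real.sqrt y / 2 = Real.sqrt y := by ring
  rw [this, pow_mul, Real.sq_sqrt hy, neg_pow y n]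

lemma bessel_meas : Measurable besselJ0 := by
  unfold besselJ0
  exact Measurable.tsum fun n => by fun_prop

lemma pow_int (n : ℕ) {c : ℝ} (hc : 0 < c) :
    IntegrableOn (fun s : ℝ => s ^ n * Real.exp (-(c * s))) (Set.Ioi 0) ∧
    ∫ s in Set.Ioi (0:ℝ), s ^ n * Real.exp (-(c * s)) = n.factorial * (c⁻¹) ^ (n + 1) := by
  have key := integral_rpow_mul_exp_neg_mul_Ioi (a := (n:ℝ) + 1) (r := c) (by positivity) hc
  rw [Real.Gamma_nat_eq_factorial] at key
  simp only [add_sub_cancel_right, rpow_natCast] at key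
  have e : (1 / c) ^ ((n:ℝ) + 1) = (c⁻¹) ^ (n + 1) := by
    rw [one_div]; exact_mod_cast Real.rpow_natCast (c⁻¹) (n+1)
  rw [e] at key
  refine ⟨.of_integral_ne_zero (by rw [key]; positivity), ?_⟩
  rw [key]; ring

lemma bessel_laplace {x c : ℝ} (hx : 0 ≤ x) (hc : 0 < c) :
    ∫ s in Set.Ioi (0:ℝ), besselJ0 (2 * Real.sqrt (x * s)) * Real.exp (-(c * s))
      = c⁻¹ * Real.exp (-(x / c)) := by
  have e1 : ∀ y : ℝ, ∀ n : ℕ, ∀ s : ℝ, (-(y * s)) ^ n / ((n.factorial : ℝ)) ^ 2 * Real.exp (-(c * s))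
      = ((-y) ^ n / ((n.factorial : ℝ)) ^ 2) * (s ^ n * Real.exp (-(c * s))) := by
    intro y n s
    rw [← neg_mul, mul_pow]; ring
  have e2 : ∀ y : ℝ, ∀ n : ℕ, ∫ s in Set.Ioi (0:ℝ), ((-y) ^ n / ((n.factorial : ℝ)) ^ 2) * (s ^ n * Real.exp (-(c * s)))
      = c⁻¹ * ((-(y / c)) ^ n / (n.factorial : ℝ)) := by
    intro y n
    have := n.factorial_pos
    rw [integral_const_mul, (pow_int n hc).2, ← neg_div, div_pow, inv_pow]
    field_simp
    ring
  have hs := hasSum_integral_of_summable_integral_norm (μ := volume.restrict (Set.Ioi (0:ℝ)))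
    (F := fun (n : ℕ) (s : ℝ) => ((-x) ^ n / ((n.factorial : ℝ)) ^ 2) * (s ^ n * Real.exp (-(c * s))))
    (fun n => (pow_int n hc).1.const_mul _) (by
      have h1 : ∀ n : ℕ, ∫ s in Set.Ioi (0:ℝ), ‖((-x) ^ n / ((n.factorial : ℝ)) ^ 2) * (s ^ n * Real.exp (-(c * s)))‖
        = c⁻¹ * ((x / c) ^ n / (n.factorial : ℝ)) := by
        intro n
        have := e2 (-x) n
        rw [neg_div, neg_neg, neg_neg] at this
        rw [← this]
        refine setIntegral_congr_fun measurableSet_Ioi fun s hs => ?_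
        have hs : 0 < s := hs
        simp only [norm_mul, norm_div, norm_pow, norm_neg, Real.norm_eq_abs, abs_of_nonneg hx,
          abs_of_pos hs, Real.abs_exp, Nat.abs_cast]
      simp_rw [h1]
      exact (exp_hasSum _).summable.mul_left _)
  simp_rw [e2] at hs
  have h3 := ((exp_hasSum (-(x/c))).mul_left c⁻¹).unique hs
  rw [h3]
  refine setIntegral_congr_fun measurableSet_Ioi fun s hs => ?_
  have hs : 0 < s := hs
  beta_reduce
  rw [bessel_sqrt (by positivity), ← tsum_mul_right]
  exact tsum_congr fun n => e1 x n s

lemma bessel_bound {x s d : ℝ} (hx : 0 ≤ x) (hs : 0 ≤ s) (hd : 0 < d) :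
    |besselJ0 (2 * Real.sqrt (x * s))| ≤ Real.exp (x / d) * Real.exp (d * s) := by
  rw [bessel_sqrt (by positivity), ← Real.norm_eq_abs]
  refine tsum_of_norm_bounded ((exp_hasSum (d * s)).mul_left _) fun n => ?_
  have h1 := Real.pow_div_factorial_le_exp (x := x / d) (by positivity) n
  have := n.factorial_pos
  have h2 : ‖(-(x * s)) ^ n / ((n.factorial : ℝ)) ^ 2‖ = ((x/d) ^ n / n.factorial) * ((d * s) ^ n / n.factorial) := by
    rw [norm_div, norm_pow, norm_neg, norm_pow, Real.norm_of_nonneg (by positivity),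
      Real.norm_of_nonneg (by positivity), mul_pow, mul_pow, div_pow]
    field_simp
  rw [h2]
  gcongr

section
variable {Ω : Type*} [MeasurableSpace Ω] (ν : Measure Ω) [IsFiniteMeasure ν]
    (Λ : Ω → ℝ)

lemma bounded_int {g : Ω → ℝ} (hg : Measurable g) (C : ℝ) (h : ∀ ω, |g ω| ≤ C) :
    Integrable g ν :=
  Integrable.of_bound hg.aestronglyMeasurable C (Filter.Eventually.of_forall h)

lemma h_formula (hΛmeas : Measurable Λ) (hΛnonneg : ∀ ω, 0 ≤ Λ ω) {a x : ℝ} (ha : 0 < a)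
    (hx : 0 ≤ x) :
    ∫ s in Set.Ioi (0:ℝ), besselJ0 (2 * Real.sqrt (x * s)) * Real.exp (-(a * s)) *
      ∫ ω, Real.exp (-(s * Λ ω)) ∂ν
    = ∫ ω, (Λ ω + a)⁻¹ * Real.exp (-(x / (Λ ω + a))) ∂ν := by
  simp_rw [← integral_const_mul]
  rw [integral_integral_swap]
  · refine integral_congr_ae (Filter.Eventually.of_forall fun ω => ?_)
    have := hΛnonneg ω
    simp only
    rw [← bessel_laplace hx (by positivity : 0 < Λ ω + a)]
    congr 1 with s
    rw [mul_assoc, ← Real.exp_add]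
    congr 2; ring
  · have hb : IntegrableOn (fun s : ℝ => Real.exp (x / (a/2)) * Real.exp (-(a/2) * s)) (Set.Ioi 0) :=
      (exp_neg_integrableOn_Ioi 0 (by positivity)).const_mul _
    have hp := Integrable.mul_prod hb (integrable_const (μ := ν) (1:ℝ))
    refine hp.mono' ?_ ?_
    · have := bessel_meas
      apply Measurable.aestronglyMeasurable
      unfold Function.uncurry
      fun_prop
    · have : ∀ᵐ p : ℝ × Ω ∂((volume.restrict (Set.Ioi (0:ℝ))).prod ν), p.1 ∈ Set.Ioi (0:ℝ) :=
        Measure.quasiMeasurePreserving_fst.ae (ae_restrict_mem measurableSet_Ioi)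
      filter_upwards [this] with p hp
      have hp : 0 < p.1 := hp
      have h1 := bessel_bound hx hp.le (by positivity : 0 < a/2)
      have h2 : Real.exp (-(p.1 * Λ p.2)) ≤ 1 := by
        rw [Real.exp_le_one_iff]; nlinarith [mul_nonneg hp.le (hΛnonneg p.2)]
      simp only [Function.uncurry, norm_mul, Real.norm_eq_abs, Real.abs_exp]
      have h3 : Real.exp (-(a/2) * p.1) = Real.exp (a/2*p.1) * Real.exp (-(a * p.1)) := by
        rw [← Real.exp_add]; congr 1; ring
      rw [h3, ← mul_assoc]
      gcongr

variable {ν} in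
lemma G_deriv {u : Ω → ℝ} (hu : Measurable u) (h0 : ∀ ω, 0 ≤ u ω) {C : ℝ}
    (hC : ∀ ω, u ω ≤ C) (k : ℕ) {x : ℝ} (hx : 0 < x) :
    HasDerivAt (fun x => ∫ ω, u ω ^ k * Real.exp (-(x * u ω)) ∂ν)
      (-∫ ω, u ω ^ (k+1) * Real.exp (-(x * u ω)) ∂ν) x := by
  have hb : ∀ k : ℕ, ∀ y > 0, ∀ ω, |u ω ^ k * Real.exp (-(y * u ω))| ≤ C ^ k := by
    intro k y hy ω
    have := h0 ω
    rw [abs_of_nonneg (by positivity)]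
    have h2 : Real.exp (-(y * u ω)) ≤ 1 := by
      rw [Real.exp_le_one_iff]; nlinarith [mul_nonneg hy.le (h0 ω)]
    calc _ ≤ u ω ^ k * 1 := by gcongr
      _ ≤ C ^ k := by rw [mul_one]; gcongr; exact hC ω
  rw [← integral_neg]
  refine (hasDerivAt_integral_of_dominated_loc_of_deriv_le (s := Set.Ioi 0)
    (F := fun x ω => u ω ^ k * Real.exp (-(x * u ω)))
    (F' := fun x ω => -(u ω ^ (k+1) * Real.exp (-(x * u ω)))) (bound := fun _ => C ^ (k+1))
    (Ioi_mem_nhds hx) ?_ ?_ ?_ ?_ (integrable_const _) ?_).2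
  · exact Filter.Eventually.of_forall fun y => (by fun_prop : Measurable _).aestronglyMeasurable
  · exact bounded_int ν (by fun_prop) (C ^ k) (hb k x hx)
  · exact (by fun_prop : Measurable _).aestronglyMeasurable
  · refine Filter.Eventually.of_forall fun ω y hy => ?_
    rw [norm_neg]; exact hb (k+1) y hy ω
  · refine Filter.Eventually.of_forall fun ω y hy => ?_
    have := (((hasDerivAt_id y).mul_const (u ω)).neg.exp).const_mul (u ω ^ k)
    refine this.congr_deriv ?_
    simp only [id, pow_succ, Pi.neg_apply]; ring

variable {ν Λ} in
lemma t_deriv (hΛmeas : Measurable Λ) (hΛnonneg : ∀ ω, 0 ≤ Λ ω) {T t x : ℝ} (ht : t < T)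
    (hx : 0 < x) :
    HasDerivAt (fun τ => ∫ ω, (Λ ω + 2 * (T - τ))⁻¹ * Real.exp (-(x * (Λ ω + 2 * (T - τ))⁻¹)) ∂ν)
      (∫ ω, (2 * ((Λ ω + 2 * (T - t))⁻¹ ^ 2 * Real.exp (-(x * (Λ ω + 2 * (T - t))⁻¹)))
        - 2 * x * ((Λ ω + 2 * (T - t))⁻¹ ^ 3 * Real.exp (-(x * (Λ ω + 2 * (T - t))⁻¹)))) ∂ν) t := by
  have hb : ∀ k : ℕ, ∀ τ ∈ Set.Iio ((t + T)/2), ∀ ω, 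
     |(Λ ω + 2 * (T - τ))⁻¹ ^ k * Real.exp (-(x * (Λ ω + 2 * (T - τ))⁻¹))| ≤ ((T - t)⁻¹) ^ k := by
    intro k τ hτ ω
    have hτ : τ < (t+T)/2 := hτ
    have h0 := hΛnonneg ω
    have h1 : T - t ≤ Λ ω + 2 * (T - τ) := by linarith
    have h3 : 0 < T - t := by linarith
    have h4 : 0 < Λ ω + 2 * (T - τ) := by linarith
    rw [abs_of_nonneg (by positivity)]
    have h2 : Real.exp (-(x * (Λ ω + 2 * (T - τ))⁻¹)) ≤ 1 := by
      rw [Real.exp_le_one_iff, neg_nonpos]; positivity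
    calc _ ≤ (Λ ω + 2 * (T - τ))⁻¹ ^ k * 1 := by gcongr
      _ ≤ _ := by rw [mul_one]; gcongr
  refine (hasDerivAt_integral_of_dominated_loc_of_deriv_le (s := Set.Iio ((t + T)/2))
    (F := fun τ ω => (Λ ω + 2 * (T - τ))⁻¹ * Real.exp (-(x * (Λ ω + 2 * (T - τ))⁻¹)))
    (F' := fun t ω => (2 * ((Λ ω + 2 * (T - t))⁻¹ ^ 2 * Real.exp (-(x * (Λ ω + 2 * (T - t))⁻¹)))
        - 2 * x * ((Λ ω + 2 * (T - t))⁻¹ ^ 3 * Real.exp (-(x * (Λ ω + 2 * (T - t))⁻¹)))))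
    (bound := fun _ => 2 * (T - t)⁻¹ ^ 2 + 2 * x * (T - t)⁻¹ ^ 3)
    (Iio_mem_nhds (by linarith)) ?_ ?_ ?_ ?_ (integrable_const _) ?_).2
  · exact Filter.Eventually.of_forall fun y => (by fun_prop : Measurable _).aestronglyMeasurable
  · exact bounded_int ν (by fun_prop) _ (fun ω => by simpa using hb 1 t (by simp; linarith) ω)
  · exact (by fun_prop : Measurable _).aestronglyMeasurable
  · refine Filter.Eventually.of_forall fun ω y hy => ?_
    refine (norm_sub_le _ _).trans ?_
    rw [norm_mul, norm_mul (2 * x), Real.norm_of_nonneg (by positivity : (0:ℝ) ≤ 2),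
      Real.norm_of_nonneg (by positivity : (0:ℝ) ≤ 2 * x)]
    gcongr
    · exact hb 2 y hy ω
    · exact hb 3 y hy ω
  · refine Filter.Eventually.of_forall fun ω y hy => ?_
    have hy : y < (t+T)/2 := hy
    have h0 := hΛnonneg ω
    have h4 : Λ ω + 2 * (T - y) ≠ 0 := by linarith
    have d1 : HasDerivAt (fun τ => (Λ ω + 2 * (T - τ))) (-2) y := by
      have := (((hasDerivAt_id y).const_sub T).const_mul 2).const_add (Λ ω)
      simpa using this
    have d2 := d1.fun_inv h4
    have := d2.fun_mul ((d2.const_mul x).fun_neg.exp)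
    refine this.congr_deriv ?_
    field_simp
    ring
end

/-- Spectral model: `(P_s f, f) = ∫ exp (-(sΛ)) f² dμ =: φ s`.  With
`h(t,x) := ∫₀^∞ J₀(2√(xs)) e^{-2(T-t)s} φ(s) ds`, the function `h` satisfies
`h_t + 2x h_{xx} + 2 h_x = 0`, `h(0,x) = (𝒥^{2T}_x f, f)`, and for any `S < T` and
`0 ≤ t ≤ S`, `0 ≤ h(t,x) ≤ (U^{2(T-S)} f, f)`. -/
theorem stmt_16
    {Ω : Type*} [MeasurableSpace Ω] (μ : Measure Ω)
    (Λ : Ω → ℝ) (hΛmeas : Measurable Λ) (hΛnonneg : ∀ ω, 0 ≤ Λ ω)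
    (f : Lp ℝ 2 μ) (T : ℝ) (hT : 0 < T)
    (φ : ℝ → ℝ)
    (hφ : ∀ s, φ s = ∫ ω, Real.exp (-(s * Λ ω)) * (f ω) ^ 2 ∂μ)
    (h : ℝ → ℝ → ℝ)
    (hh : ∀ t x, h t x = ∫ s in Set.Ioi (0:ℝ),
      besselJ0 (2 * Real.sqrt (x * s)) * Real.exp (-(2 * (T - t) * s)) * φ s) :
    (∀ t ∈ Set.Ico (0:ℝ) T, ∀ x > (0:ℝ),
      deriv (fun τ => h τ x) t + 2 * x * deriv (deriv (h t)) x
        + 2 * deriv (h t) x = 0) ∧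
    (∀ x ≥ (0:ℝ),
      h 0 x = ∫ ω, (Λ ω + 2 * T)⁻¹ * Real.exp (-(x / (Λ ω + 2 * T))) * (f ω) ^ 2 ∂μ) ∧
    (∀ S < T, ∀ t, 0 ≤ t → t ≤ S → ∀ x ≥ (0:ℝ),
      0 ≤ h t x ∧ h t x ≤ ∫ ω, (Λ ω + 2 * (T - S))⁻¹ * (f ω) ^ 2 ∂μ) := by
  have hfm : Measurable (f : Ω → ℝ) := (Lp.stronglyMeasurable f).measurable
  have hgm : Measurable (fun ω => ((f ω) ^ 2).toNNReal) := (hfm.pow_const 2).real_toNNReal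
  have hfi : Integrable (fun ω => (f ω) ^ 2) μ := (Lp.memLp f).integrable_sq
  obtain ⟨ν, hν⟩ : ∃ ν, ν = μ.withDensity (fun ω => (((f ω) ^ 2).toNNReal : ENNReal)) := ⟨_, rfl⟩
  have hfin : IsFiniteMeasure ν := by
    rw [hν]; exact isFiniteMeasure_withDensity_ofReal hfi.2
  have hint : ∀ g : Ω → ℝ, ∫ ω, g ω * (f ω) ^ 2 ∂μ = ∫ ω, g ω ∂ν := by
    intro g
    rw [hν, integral_withDensity_eq_integral_smul hgm]
    refine integral_congr_ae (Filter.Eventually.of_forall fun ω => ?_)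
    simp only [NNReal.smul_def, smul_eq_mul, Real.coe_toNNReal _ (sq_nonneg (f ω))]
    ring
  simp_rw [hint] at hφ ⊢
  have hF : ∀ t < T, ∀ x ≥ 0, h t x =
      ∫ ω, (Λ ω + 2 * (T - t))⁻¹ * Real.exp (-(x / (Λ ω + 2 * (T - t)))) ∂ν := by
    intro t ht x hx
    rw [hh]
    simp_rw [hφ]
    exact h_formula ν Λ hΛmeas hΛnonneg (by linarith) hx
  refine ⟨?_, ?_, ?_⟩
  · rintro t ⟨-, ht⟩ x hx
    have e1 : (fun τ => h τ x) =ᶠ[nhds t] fun τ => ∫ ω, (Λ ω + 2 * (T - τ))⁻¹ *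
        Real.exp (-(x * (Λ ω + 2 * (T - τ))⁻¹)) ∂ν := by
      filter_upwards [Iio_mem_nhds ht] with τ hτ
      simp_rw [hF τ hτ x hx.le, div_eq_mul_inv]
    have u0 : ∀ ω, 0 ≤ (Λ ω + 2 * (T - t))⁻¹ := fun ω => by
      have := hΛnonneg ω
      exact inv_nonneg.2 (by linarith)
    have uC : ∀ ω, (Λ ω + 2 * (T - t))⁻¹ ≤ (2 * (T - t))⁻¹ := fun ω => by
      have := hΛnonneg ω
      exact inv_anti₀ (by linarith) (by linarith)
    have um : Measurable fun ω => (Λ ω + 2 * (T - t))⁻¹ := by fun_prop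
    have e2 : ∀ y > 0, HasDerivAt (h t) (-∫ ω, (Λ ω + 2 * (T - t))⁻¹ ^ 2 *
        Real.exp (-(y * (Λ ω + 2 * (T - t))⁻¹)) ∂ν) y := by
      intro y hy
      refine (G_deriv um u0 uC 1 hy).congr_of_eventuallyEq ?_
      filter_upwards [Ioi_mem_nhds hy] with z hz
      have hz : 0 < z := hz
      simp_rw [hF t ht z hz.le, div_eq_mul_inv, pow_one]
    have e3 : HasDerivAt (deriv (h t)) (∫ ω, (Λ ω + 2 * (T - t))⁻¹ ^ 3 *
        Real.exp (-(x * (Λ ω + 2 * (T - t))⁻¹)) ∂ν) x := by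
      have := (G_deriv (ν := ν) um u0 uC 2 hx).fun_neg
      rw [neg_neg] at this
      refine this.congr_of_eventuallyEq ?_
      filter_upwards [Ioi_mem_nhds hx] with z hz
      exact (e2 z hz).deriv
    have hI : ∀ k : ℕ, Integrable (fun ω => (Λ ω + 2 * (T - t))⁻¹ ^ k *
        Real.exp (-(x * (Λ ω + 2 * (T - t))⁻¹))) ν := by
      intro k
      refine bounded_int ν (by fun_prop) ((2 * (T - t))⁻¹ ^ k) fun ω => ?_
      have h0 := u0 ω
      rw [abs_of_nonneg (by positivity)]
      have h2 : Real.exp (-(x * (Λ ω + 2 * (T - t))⁻¹)) ≤ 1 := by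
        rw [Real.exp_le_one_iff, neg_nonpos]; positivity
      calc _ ≤ (Λ ω + 2 * (T - t))⁻¹ ^ k * 1 := by gcongr
        _ ≤ _ := by rw [mul_one]; exact pow_le_pow_left₀ h0 (uC ω) k
    rw [e1.deriv_eq, (t_deriv hΛmeas hΛnonneg ht hx).deriv, e3.deriv, (e2 x hx).deriv,
      integral_sub ((hI 2).const_mul _) ((hI 3).const_mul _), integral_const_mul,
      integral_const_mul]
    ring
  · intro x hx
    simpa using hF 0 hT x hx
  · intro S hS t _ htS x hx
    rw [hF t (by linarith) x hx]
    have hp : ∀ ω, 0 < Λ ω + 2 * (T - S) := fun ω => by have := hΛnonneg ω; linarith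
    have hq : ∀ ω, 0 < Λ ω + 2 * (T - t) := fun ω => by have := hp ω; linarith
    have hle : ∀ ω, (Λ ω + 2 * (T - t))⁻¹ * Real.exp (-(x / (Λ ω + 2 * (T - t)))) ≤
        (Λ ω + 2 * (T - S))⁻¹ := by
      intro ω
      have h1 := hp ω
      have h2 := hq ω
      have h3 : Real.exp (-(x / (Λ ω + 2 * (T - t)))) ≤ 1 := by
        rw [Real.exp_le_one_iff, neg_nonpos]; positivity
      calc _ ≤ (Λ ω + 2 * (T - t))⁻¹ * 1 := by gcongr
        _ ≤ _ := by rw [mul_one]; exact inv_anti₀ h1 (by linarith)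
    have hpos : ∀ ω, 0 ≤ (Λ ω + 2 * (T - t))⁻¹ * Real.exp (-(x / (Λ ω + 2 * (T - t)))) := by
      intro ω
      have h2 := hq ω
      positivity
    refine ⟨integral_nonneg hpos, ?_⟩
    refine integral_mono_of_nonneg (Filter.Eventually.of_forall hpos) ?_
      (Filter.Eventually.of_forall hle)
    refine bounded_int ν (by fun_prop) ((2 * (T - S))⁻¹) fun ω => ?_
    rw [abs_of_nonneg (inv_nonneg.2 (hp ω).le)]
    exact inv_anti₀ (by linarith) (by have := hΛnonneg ω; linarith)
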